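/- arXiv:0812.1005 — 6 statements merged into one kernel-verified Lean document; each statement's English description precedes it below -/
import Mathlib

section
/- For every integer i with 1 ≤ i ≤ N and every w ∈ S_N, ℓ(σ^{−i} w) − ℓ(w) = Σ_{r : w(r) ≤ i} (N + 1 − 2r), where the sum runs over all r ∈ {1,…,N} with w(r) ≤ i. (Equivalently, ℓ(σ^{−i} w) − ℓ(w) = ⟨δ, w^{−1}ϖ_i⟩, where δ := (N−1, N−3, …, 1−N) ∈ ℤ^N, ϖ_i ∈ ℤ^N is the sum of the first i standard basis vectors, S_N acts on ℤ^N by (wμ)_r := μ_{w^{−1}(r)}, and ⟨·,·⟩ is the standard inner product.) -/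
/-- The adjacent transposition `s i` interchanging `i` and `i+1`, as a permutation of `ℕ`
(labels are 1-based; only `s 1, …, s (N-1)` are used, and they permute `{1, …, N}`). -/
def s (i : ℕ) : Equiv.Perm ℕ := Equiv.swap i (i + 1)

/-- `σ := s 1 * s 2 * ⋯ * s (N-1)`, the `N`-cycle sending `N` to `1` and `i` to `i+1`
for `1 ≤ i < N`. -/
def sigma (N : ℕ) : Equiv.Perm ℕ :=
  ((List.range (N - 1)).map fun t => s (t + 1)).prod

/-- The length `ℓ(w)` of `w`, i.e. the number of inversions of `w` on `{1, …, N}`. -/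
def len (N : ℕ) (w : Equiv.Perm ℕ) : ℕ :=
  ((Finset.Icc 1 N ×ˢ Finset.Icc 1 N).filter fun p => p.1 < p.2 ∧ w p.2 < w p.1).card

theorem prod_map_s_range_apply (n r : ℕ) (hr : 1 ≤ r) :
    ((List.range n).map fun t => s (t + 1)).prod r =
      if r ≤ n then r + 1 else if r = n + 1 then 1 else r := by
  induction n generalizing r with
  | zero =>
    simp only [List.range_zero, List.map_nil, List.prod_nil, Equiv.Perm.one_apply]
    split_ifs <;> omega
  | succ n ih =>
    simp only [List.range_succ, List.map_append, List.map_cons, List.map_nil,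
      List.prod_append, List.prod_singleton, Equiv.Perm.mul_apply, s, Equiv.swap_apply_def] at ih ⊢
    rw [ih _ (by split_ifs <;> omega)]
    split_ifs <;> omega

theorem sigma_apply (N r : ℕ) (hr : 1 ≤ r) (hrN : r ≤ N) :
    sigma N r = if r = N then 1 else r + 1 := by
  rw [sigma, prod_map_s_range_apply _ _ hr]
  split_ifs <;> omega

theorem sigma_pow_apply (N i r : ℕ) (hi : i ≤ N) (hr : 1 ≤ r) (hrN : r ≤ N) :
    (sigma N ^ i) r = if r + i ≤ N then r + i else r + i - N := by
  induction i with
  | zero => simp [hrN]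
  | succ i ih =>
    rw [pow_succ', Equiv.Perm.mul_apply, ih (by omega),
      sigma_apply _ _ (by split_ifs <;> omega) (by split_ifs <;> omega)]
    split_ifs <;> omega

theorem sigma_pow_inv_apply (N i r : ℕ) (hi : i ≤ N) (hr : 1 ≤ r) (hrN : r ≤ N) :
    (sigma N ^ i)⁻¹ r = if r ≤ i then r + N - i else r - i := by
  rw [Equiv.Perm.inv_eq_iff_eq,
    sigma_pow_apply _ _ _ hi (by split_ifs <;> omega) (by split_ifs <;> omega)]
  split_ifs <;> omega

theorem len_eq_sum (N : ℕ) (w : Equiv.Perm ℕ) :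
    (len N w : ℤ) = ∑ p ∈ Finset.Icc 1 N, ∑ q ∈ Finset.Icc 1 N,
      if p < q ∧ w q < w p then 1 else 0 := by
  rw [len, Finset.card_filter, Finset.sum_product]
  push_cast
  rfl

theorem sum_pairs_sub (N : ℕ) (a : ℕ → ℤ) :
    ∑ p ∈ Finset.Icc 1 N, ∑ q ∈ Finset.Icc 1 N, (if p < q then a p - a q else 0) =
      ∑ r ∈ Finset.Icc 1 N, a r * ((N : ℤ) + 1 - 2 * r) := by
  have hsplit : ∀ p q : ℕ, (if p < q then a p - a q else 0) =
      (if p < q then a p else 0) - if p < q then a q else 0 := by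
    intro p q
    split_ifs <;> simp
  simp only [hsplit, Finset.sum_sub_distrib]
  rw [Finset.sum_comm (f := fun p q => if p < q then a q else 0), ← Finset.sum_sub_distrib]
  refine Finset.sum_congr rfl fun r hr => ?_
  rw [Finset.mem_Icc] at hr
  have habove : (Finset.Icc 1 N).filter (r < ·) = Finset.Ioc r N := by
    ext; simp; omega
  have hbelow : (Finset.Icc 1 N).filter (· < r) = Finset.Ico 1 r := by
    ext; simp; omega
  rw [← Finset.sum_filter, ← Finset.sum_filter, habove, hbelow]
  simp only [Finset.sum_const, Nat.card_Ioc, Nat.card_Ico, nsmul_eq_mul]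
  rw [Nat.cast_sub hr.2, Nat.cast_sub hr.1]
  push_cast
  ring

/-- For `1 ≤ i ≤ N` and `w ∈ S_N` (a permutation of `ℕ` fixing the complement of `{1,…,N}`),
`ℓ(σ^{-i} w) - ℓ(w) = ∑_{r : w(r) ≤ i} (N + 1 - 2r)`, the sum being over all
`r ∈ {1, …, N}` with `w r ≤ i`. -/
theorem length_sigma_inv_mul (N i : ℕ) (hN : 2 ≤ N) (hi : 1 ≤ i) (hiN : i ≤ N)
    (w : Equiv.Perm ℕ) (hw : ∀ r, r ∉ Finset.Icc 1 N → w r = r) :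
    (len N (((sigma N) ^ i)⁻¹ * w) : ℤ) - (len N w : ℤ) =
      ∑ r ∈ (Finset.Icc 1 N).filter fun r => w r ≤ i, ((N : ℤ) + 1 - 2 * (r : ℤ)) := by
  have hmaps : ∀ r ∈ Finset.Icc 1 N, 1 ≤ w r ∧ w r ≤ N := by
    intro r hr
    by_contra h
    have hfix := w.injective (hw (w r) (by rwa [Finset.mem_Icc]))
    rw [hfix, ← Finset.mem_Icc] at h
    exact h hr
  have hinv : ∀ r ∈ Finset.Icc 1 N, ((sigma N ^ i)⁻¹ * w) r =
      if w r ≤ i then w r + N - i else w r - i := fun r hr =>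
    sigma_pow_inv_apply N i (w r) hiN (hmaps r hr).1 (hmaps r hr).2
  have hpairs := sum_pairs_sub N fun r => if w r ≤ i then 1 else 0
  simp only [ite_mul, one_mul, zero_mul] at hpairs
  rw [Finset.sum_filter, ← hpairs, len_eq_sum, len_eq_sum, ← Finset.sum_sub_distrib]
  refine Finset.sum_congr rfl fun p hp => ?_
  rw [← Finset.sum_sub_distrib]
  refine Finset.sum_congr rfl fun q hq => ?_
  rw [hinv p hp, hinv q hq]
  have hp' := hmaps p hp
  have hq' := hmaps q hq
  split_ifs <;> omega
end

section
/- For all λ, μ ∈ ℤ^N and all t, γ ∈ T such that all θ-factors appearing in the denominators of W_κ(t,γ) and of W_κ(q^{−λ}t, q^{μ}γ) are nonzero, one has W_κ(q^{−λ} t, q^{μ} γ) = k^{−⟨δ, λ+μ⟩} · t^{w_0(μ)} · γ^{−w_0(λ)} · q^{−⟨w_0(λ), μ⟩} · W_κ(t, γ). Here q^{−λ}t := (q^{−λ_1}t_1,…,q^{−λ_N}t_N), w_0(λ) := (λ_N, λ_{N−1}, …, λ_1), t^{ν} := ∏_{i=1}^N t_i^{ν_i} for ν ∈ ℤ^N,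 and ⟨·,·⟩ is the standard bilinear pairing on ℤ^N. -/
/-- The renormalized Jacobi theta function
`θ(z) = ∏_{m ≥ 0} (1 - q^m z)(1 - q^{m+1} z⁻¹)`. -/
noncomputable def theta (q : ℝ) (z : ℂ) : ℂ :=
  ∏' m : ℕ, ((1 - (q : ℂ) ^ m * z) * (1 - (q : ℂ) ^ (m + 1) * z⁻¹))

/-- `δ_i = N + 1 - 2i` in 1-based labels; with 0-based `i : Fin N` this is `N - 1 - 2i`. -/
def delta (N : ℕ) (i : Fin N) : ℤ := (N : ℤ) - 1 - 2 * (i : ℕ)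

/-- `W_κ(t, γ) = ∏_{i=1}^N θ(κ t_i γ_{N-i+1}⁻¹) /
(θ(κ k^{δ_i} t_i) θ(κ k^{-δ_i} γ_{N-i+1}⁻¹))`; the 1-based index `N - i + 1` is the 0-based
index `i.rev`. -/
noncomputable def W (N : ℕ) (q : ℝ) (k κ : ℂ) (t γ : Fin N → ℂ) : ℂ :=
  ∏ i : Fin N,
    theta q (κ * t i * (γ i.rev)⁻¹) /
      (theta q (κ * k ^ delta N i * t i) * theta q (κ * k ^ (-delta N i) * (γ i.rev)⁻¹))

/-- The `q`-Pochhammer symbol `(z; q)_∞ = ∏_{m ≥ 0} (1 - q^m z)`. -/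
noncomputable def qPochhammer (q : ℝ) (z : ℂ) : ℂ := ∏' m : ℕ, (1 - (q : ℂ) ^ m * z)

lemma multipliable_qPochhammer {q : ℝ} (hq0 : 0 < q) (hq1 : q < 1) (z : ℂ) :
    Multipliable fun m : ℕ => 1 - (q : ℂ) ^ m * z := by
  have hs : Summable fun m : ℕ => ‖-((q : ℂ) ^ m * z)‖ := by
    simp only [norm_neg, norm_mul, norm_pow, Complex.norm_real, Real.norm_of_nonneg hq0.le]
    exact (summable_geometric_of_lt_one hq0.le hq1).mul_right _
  simpa only [sub_eq_add_neg] using multipliable_one_add_of_summable hs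

lemma qPochhammer_eq_mul {q : ℝ} (hq0 : 0 < q) (hq1 : q < 1) (z : ℂ) :
    qPochhammer q z = (1 - z) * qPochhammer q (q * z) := by
  have hm : Multipliable fun m : ℕ => 1 - (q : ℂ) ^ (m + 1) * z := by
    simpa only [pow_succ, mul_assoc] using multipliable_qPochhammer hq0 hq1 (q * z)
  have hsplit := tprod_eq_zero_mul' (f := fun m : ℕ => 1 - (q : ℂ) ^ m * z) hm
  simpa only [qPochhammer, pow_succ, mul_assoc, pow_zero, one_mul] using hsplit

lemma theta_eq_qPochhammer_mul {q : ℝ} (hq0 : 0 < q) (hq1 : q < 1) (z : ℂ) :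
    theta q z = qPochhammer q z * qPochhammer q (q * z⁻¹) := by
  simp only [theta, qPochhammer, pow_succ, mul_assoc]
  exact (multipliable_qPochhammer hq0 hq1 z).tprod_mul
    (multipliable_qPochhammer hq0 hq1 (q * z⁻¹))

lemma theta_q_mul {q : ℝ} (hq0 : 0 < q) (hq1 : q < 1) {z : ℂ} (hz : z ≠ 0) :
    theta q (q * z) = -z⁻¹ * theta q z := by
  have hq : (q : ℂ) ≠ 0 := by exact_mod_cast hq0.ne'
  have hinv : (q : ℂ) * (q * z)⁻¹ = z⁻¹ := by field_simp
  rw [theta_eq_qPochhammer_mul hq0 hq1, theta_eq_qPochhammer_mul hq0 hq1 z, hinv,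
    qPochhammer_eq_mul hq0 hq1 z, qPochhammer_eq_mul hq0 hq1 z⁻¹]
  field_simp
  ring

/-- The `z`-independent part of the multiplier relating `θ(q^{-n} z)` to `θ(z)`. -/
noncomputable def thetaMultiplier (q : ℝ) (n : ℤ) : ℂ :=
  (-1) ^ n * (q : ℂ) ^ (-(n * (n + 1) / 2))

lemma thetaMultiplier_ne_zero {q : ℝ} (hq0 : 0 < q) (n : ℤ) : thetaMultiplier q n ≠ 0 := by
  have hq : (q : ℂ) ≠ 0 := by exact_mod_cast hq0.ne'
  exact mul_ne_zero (zpow_ne_zero _ (by norm_num)) (zpow_ne_zero _ hq)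

lemma thetaMultiplier_add {q : ℝ} (hq0 : 0 < q) (a b : ℤ) :
    thetaMultiplier q (a + b) =
      thetaMultiplier q a * thetaMultiplier q b * (q : ℂ) ^ (-(a * b)) := by
  have hq : (q : ℂ) ≠ 0 := by exact_mod_cast hq0.ne'
  have hexp : -((a + b) * (a + b + 1) / 2) =
      -(a * (a + 1) / 2) + -(b * (b + 1) / 2) + -(a * b) := by
    have ha := Int.ediv_mul_cancel (Int.even_mul_succ_self a).two_dvd
    have hb := Int.ediv_mul_cancel (Int.even_mul_succ_self b).two_dvd
    have hab := Int.ediv_mul_cancel (Int.even_mul_succ_self (a + b)).two_dvd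
    linarith
  simp only [thetaMultiplier]
  rw [hexp, zpow_add₀ hq, zpow_add₀ hq, zpow_add₀ (by norm_num : (-1 : ℂ) ≠ 0)]
  ring

lemma theta_q_zpow_neg_mul {q : ℝ} (hq0 : 0 < q) (hq1 : q < 1) (n : ℤ) {z : ℂ} (hz : z ≠ 0) :
    theta q ((q : ℂ) ^ (-n) * z) = thetaMultiplier q n * z ^ n * theta q z := by
  have hq : (q : ℂ) ≠ 0 := by exact_mod_cast hq0.ne'
  have step (n : ℤ) : theta q ((q : ℂ) ^ (-n) * z) =
      -((q : ℂ) ^ (-(n + 1)) * z)⁻¹ * theta q ((q : ℂ) ^ (-(n + 1)) * z) := by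
    rw [← theta_q_mul hq0 hq1 (mul_ne_zero (zpow_ne_zero _ hq) hz), ← mul_assoc,
      ← zpow_one_add₀ hq]
    congr 3
    ring
  have hmul (n : ℤ) : thetaMultiplier q n * z ^ n =
      -((q : ℂ) ^ (-(n + 1)) * z)⁻¹ * (thetaMultiplier q (n + 1) * z ^ (n + 1)) := by
    have hone : thetaMultiplier q 1 = -(q : ℂ) ^ (-1 : ℤ) := by norm_num [thetaMultiplier]
    rw [thetaMultiplier_add hq0, hone, zpow_add₀ hz, neg_add, zpow_add₀ hq, mul_one, zpow_one]
    have := zpow_ne_zero (-n) hq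
    field_simp
  have hcoef (n : ℤ) : -((q : ℂ) ^ (-(n + 1)) * z)⁻¹ ≠ 0 :=
    neg_ne_zero.mpr (inv_ne_zero (mul_ne_zero (zpow_ne_zero _ hq) hz))
  induction n using Int.induction_on with
  | zero => simp [thetaMultiplier]
  | succ n ih =>
    rw [step, hmul, mul_assoc] at ih
    exact mul_left_cancel₀ (hcoef _) ih
  | pred n ih =>
    rw [step, hmul, sub_add_cancel, ih]
    ring

lemma delta_rev {N : ℕ} (i : Fin N) : delta N i.rev = -delta N i := by
  simp only [delta, Fin.val_rev]
  have := i.isLt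
  omega

lemma theta_quotient_q_zpow_shift {q : ℝ} (hq0 : 0 < q) (hq1 : q < 1) {c κ x y : ℂ}
    (hc : c ≠ 0) (hκ : κ ≠ 0) (hx : x ≠ 0) (hy : y ≠ 0) (a b : ℤ) :
    theta q (κ * ((q : ℂ) ^ (-a) * x) * ((q : ℂ) ^ b * y)⁻¹) /
        (theta q (κ * c * ((q : ℂ) ^ (-a) * x)) * theta q (κ * c⁻¹ * ((q : ℂ) ^ b * y)⁻¹)) =
      c ^ (b - a) * x ^ b * y ^ (-a) * (q : ℂ) ^ (-(a * b)) *
        (theta q (κ * x * y⁻¹) / (theta q (κ * c * x) * theta q (κ * c⁻¹ * y⁻¹))) := by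
  have hq : (q : ℂ) ≠ 0 := by exact_mod_cast hq0.ne'
  have e₁ : κ * ((q : ℂ) ^ (-a) * x) * ((q : ℂ) ^ b * y)⁻¹ =
      (q : ℂ) ^ (-(a + b)) * (κ * x * y⁻¹) := by
    rw [mul_inv, ← zpow_neg, neg_add, zpow_add₀ hq]
    ring
  have e₂ : κ * c * ((q : ℂ) ^ (-a) * x) = (q : ℂ) ^ (-a) * (κ * c * x) := by ring
  have e₃ : κ * c⁻¹ * ((q : ℂ) ^ b * y)⁻¹ = (q : ℂ) ^ (-b) * (κ * c⁻¹ * y⁻¹) := by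
    rw [mul_inv, ← zpow_neg]
    ring
  have ha := thetaMultiplier_ne_zero hq0 a
  have hb := thetaMultiplier_ne_zero hq0 b
  rw [e₁, e₂, e₃, theta_q_zpow_neg_mul hq0 hq1 _ (by positivity),
    theta_q_zpow_neg_mul hq0 hq1 _ (by positivity), theta_q_zpow_neg_mul hq0 hq1 _ (by positivity),
    thetaMultiplier_add hq0]
  have hcoef : (κ * x * y⁻¹) ^ (a + b) =
      c ^ (b - a) * x ^ b * y ^ (-a) * ((κ * c * x) ^ a * (κ * c⁻¹ * y⁻¹) ^ b) := by
    simp only [mul_zpow, inv_zpow, zpow_sub₀ hc, zpow_neg, zpow_add₀ hκ, zpow_add₀ hx,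
      zpow_add₀ hy]
    field_simp
  have h₂ : (κ * c * x) ^ a ≠ 0 := by positivity
  have h₃ : (κ * c⁻¹ * y⁻¹) ^ b ≠ 0 := by positivity
  rw [hcoef]
  field_simp

/-- The difference equations for `W_κ`: for `λ, μ ∈ ℤ^N` and `t, γ ∈ T` with all θ-factors in
the denominators of `W_κ(t,γ)` and of `W_κ(q^{-λ}t, q^{μ}γ)` nonzero,
`W_κ(q^{-λ}t, q^{μ}γ) = k^{-⟨δ, λ+μ⟩} t^{w₀(μ)} γ^{-w₀(λ)} q^{-⟨w₀(λ), μ⟩} W_κ(t, γ)`,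
where `w₀` reverses the components. -/
theorem W_difference_equations (N : ℕ) (hN : 2 ≤ N) (q : ℝ) (hq0 : 0 < q) (hq1 : q < 1)
    (k κ : ℂ) (hk : k ≠ 0) (hκ : κ ≠ 0)
    (lam mu : Fin N → ℤ) (t γ : Fin N → ℂ)
    (ht : ∀ i, t i ≠ 0) (hγ : ∀ i, γ i ≠ 0)
    (h1 : ∀ i : Fin N, theta q (κ * k ^ delta N i * t i) ≠ 0)
    (h2 : ∀ i : Fin N, theta q (κ * k ^ (-delta N i) * (γ i.rev)⁻¹) ≠ 0)
    (h3 : ∀ i : Fin N, theta q (κ * k ^ delta N i * ((q : ℂ) ^ (-lam i) * t i)) ≠ 0)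
    (h4 : ∀ i : Fin N,
      theta q (κ * k ^ (-delta N i) * ((q : ℂ) ^ mu i.rev * γ i.rev)⁻¹) ≠ 0) :
    W N q k κ (fun i => (q : ℂ) ^ (-lam i) * t i) (fun i => (q : ℂ) ^ mu i * γ i) =
      k ^ (-(∑ i, delta N i * (lam i + mu i))) *
        (∏ i, t i ^ mu i.rev) * (∏ i, γ i ^ (-lam i.rev)) *
        (q : ℂ) ^ (-(∑ i, lam i.rev * mu i)) * W N q k κ t γ := by
  have hterm : W N q k κ (fun i => (q : ℂ) ^ (-lam i) * t i) (fun i => (q : ℂ) ^ mu i * γ i) =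
      ∏ i, k ^ (delta N i * (mu i.rev - lam i)) * t i ^ mu i.rev * γ i.rev ^ (-lam i) *
        (q : ℂ) ^ (-(lam i * mu i.rev)) *
        (theta q (κ * t i * (γ i.rev)⁻¹) /
          (theta q (κ * k ^ delta N i * t i) *
            theta q (κ * k ^ (-delta N i) * (γ i.rev)⁻¹))) := by
    refine Finset.prod_congr rfl fun i _ => ?_
    simp only [zpow_neg k, zpow_mul k]
    exact theta_quotient_q_zpow_shift hq0 hq1 (zpow_ne_zero _ hk) hκ (ht i) (hγ i.rev) _ _
  have hq : (q : ℂ) ≠ 0 := by exact_mod_cast hq0.ne'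
  have prod_zpow {c : ℂ} (hc : c ≠ 0) (f : Fin N → ℤ) : ∏ i, c ^ f i = c ^ ∑ i, f i := by
    induction (Finset.univ : Finset (Fin N)) using Finset.cons_induction with
    | empty => simp
    | cons a s ha ih => rw [Finset.prod_cons, Finset.sum_cons, ih, zpow_add₀ hc]
  have hk_exp : ∑ i, delta N i * (mu i.rev - lam i) = -∑ i, delta N i * (lam i + mu i) := by
    have hrev : ∑ i, delta N i * mu i.rev = -∑ i, delta N i * mu i := by
      rw [← Equiv.sum_comp Fin.revPerm, ← Finset.sum_neg_distrib]
      simp [delta_rev]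
    simp only [mul_sub, mul_add, Finset.sum_sub_distrib, Finset.sum_add_distrib, hrev]
    ring
  have hq_exp : ∑ i, -(lam i * mu i.rev) = -∑ i, lam i.rev * mu i := by
    rw [← Equiv.sum_comp Fin.revPerm, ← Finset.sum_neg_distrib]
    simp
  have hγ_prod : ∏ i, γ i.rev ^ (-lam i) = ∏ i, γ i ^ (-lam i.rev) := by
    rw [← Equiv.prod_comp Fin.revPerm]
    simp
  rw [hterm, W]
  simp only [Finset.prod_mul_distrib (s := Finset.univ)]
  rw [prod_zpow hk, prod_zpow hq, hk_exp, hq_exp, hγ_prod]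
end

section
/- Let v_+ := Σ_{w ∈ S_N} k^{ℓ(w)} e_w ∈ V, let σ := s_1 s_2 ⋯ s_{N−1}, and for ζ ∈ (ℂ∖{0})^N let P_ζ ∈ End(V) be defined by P_ζ e_w := ζ_{w^{−1}(N)} e_{σ w}. Then: (i) 𝖳_i v_+ = k v_+ for all 1 ≤ i ≤ N−1, and hence R_i(z) v_+ = v_+ for every z ∈ ℂ∖{0} with z ∉ {1, k^{−2}}; (ii) for every ζ ∈ (ℂ∖{0})^N and every 1 ≤ i ≤ N, P_ζ^i v_+ = Σ_{w ∈ S_N} k^{ℓ(w)} ( ∏_{r : w(r) ≤ i} k^{N+1−2r} ζ_r ) e_w, the product running over all r ∈ {1,…,N} with w(r) ≤ i; (iii) in particular, for ζ = k^{−δ} := (k^{1−N}, k^{3−N}, …, k^{N−1}) one has P_{k^{−δ}}^i v_+ = v_+ for all 1 ≤ i ≤ N. -/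
open scoped Classical

/-- The adjacent transposition of `i` and `i+1` in `S_N` (0-based labels `0, …, N-1`). -/
def sw (N i : ℕ) : Equiv.Perm (Fin N) :=
  if h : i + 1 < N then Equiv.swap ⟨i, Nat.lt_of_succ_lt h⟩ ⟨i + 1, h⟩ else 1

/-- The length `ℓ(w)`: the number of inversions of `w ∈ S_N`. -/
def lenF (N : ℕ) (w : Equiv.Perm (Fin N)) : ℕ :=
  ((Finset.univ ×ˢ Finset.univ : Finset (Fin N × Fin N)).filter
    fun p => p.1 < p.2 ∧ w p.2 < w p.1).card

/-- `σ := s_1 s_2 ⋯ s_{N-1}` (0-based: `sw 0 * sw 1 * ⋯ * sw (N-2)`). -/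
def sigmaF (N : ℕ) : Equiv.Perm (Fin N) :=
  ((List.range (N - 1)).map fun t => sw N t).prod

/-- The defining property of the operators `𝖳_i` on the vector space `V` with basis
`{e_w : w ∈ S_N}` (here `V = (S_N → ℂ)`, `e_w = Pi.single w 1`). -/
def IsHeckeT (N : ℕ) (k : ℂ) (T : ℕ → Module.End ℂ (Equiv.Perm (Fin N) → ℂ)) : Prop :=
  ∀ (i : ℕ) (h : i + 1 < N) (w : Equiv.Perm (Fin N)),
    T i (Pi.single w 1) =
      if w⁻¹ ⟨i, Nat.lt_of_succ_lt h⟩ < w⁻¹ ⟨i + 1, h⟩ then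
        (Pi.single (sw N i * w) 1 : Equiv.Perm (Fin N) → ℂ)
      else (k - k⁻¹) • (Pi.single w 1 : Equiv.Perm (Fin N) → ℂ) +
        (Pi.single (sw N i * w) 1 : Equiv.Perm (Fin N) → ℂ)

/-- `R_i(z) := c_k(z)⁻¹ (𝖳_i - k·id) + id`, with `c_k(z) = (k⁻¹ - k z)/(1 - z)`. -/
noncomputable def Rop (k : ℂ) {V : Type*} [AddCommGroup V] [Module ℂ V]
    (T : Module.End ℂ V) (z : ℂ) : Module.End ℂ V :=
  ((k⁻¹ - k * z) / (1 - z))⁻¹ • (T - k • (1 : Module.End ℂ V)) + 1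

/-- `v₊ := ∑_{w ∈ S_N} k^{ℓ(w)} e_w`. -/
noncomputable def vplus (N : ℕ) (k : ℂ) : Equiv.Perm (Fin N) → ℂ :=
  ∑ w : Equiv.Perm (Fin N), k ^ lenF N w • (Pi.single w 1 : Equiv.Perm (Fin N) → ℂ)

/-- The adjacent transposition `sw N i` in terms of the underlying natural numbers. -/
lemma sw_apply_val {N i : ℕ} (h : i + 1 < N) (x : Fin N) :
    (sw N i x : ℕ) =
      if (x : ℕ) = i then i + 1 else if (x : ℕ) = i + 1 then i else (x : ℕ) := by
  rw [sw, dif_pos h, Equiv.swap_apply_def]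
  simp only [Fin.ext_iff]
  split_ifs <;> simp_all

lemma sw_mul_self (N i : ℕ) : sw N i * sw N i = 1 := by
  unfold sw
  split_ifs <;> simp

lemma prod_sw_apply_val {N m : ℕ} (hm : m < N) (x : Fin N) :
    (((List.range m).map fun t => sw N t).prod x : ℕ) =
      if (x : ℕ) < m then (x : ℕ) + 1 else if (x : ℕ) = m then 0 else (x : ℕ) := by
  induction m generalizing x with
  | zero => simp
  | succ m ih =>
    rw [List.range_succ, List.map_append, List.prod_append, List.map_singleton,
      List.prod_singleton, Equiv.Perm.mul_apply, ih (by omega), sw_apply_val hm]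
    split_ifs <;> omega

/-- `σ` is the cycle sending `x` to `x + 1` and the last label to the first one. -/
lemma sigmaF_apply_val {N : ℕ} (x : Fin N) :
    (sigmaF N x : ℕ) = if (x : ℕ) + 1 = N then 0 else (x : ℕ) + 1 := by
  have hx := x.isLt
  rw [sigmaF, prod_sw_apply_val (by omega)]
  split_ifs <;> omega

lemma lenF_sw_mul {N i : ℕ} (h : i + 1 < N) (w : Equiv.Perm (Fin N))
    (hw : w⁻¹ ⟨i, Nat.lt_of_succ_lt h⟩ < w⁻¹ ⟨i + 1, h⟩) :
    lenF N (sw N i * w) = lenF N w + 1 := by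
  have key : ((Finset.univ ×ˢ Finset.univ : Finset (Fin N × Fin N)).filter
      fun p => p.1 < p.2 ∧ (sw N i * w) p.2 < (sw N i * w) p.1) =
      insert (w⁻¹ ⟨i, Nat.lt_of_succ_lt h⟩, w⁻¹ ⟨i + 1, h⟩)
        ((Finset.univ ×ˢ Finset.univ : Finset (Fin N × Fin N)).filter
          fun p => p.1 < p.2 ∧ w p.2 < w p.1) := by
    ext ⟨p, q⟩
    have hval : ∀ (y : Fin N) (x : Fin N), x = w⁻¹ y ↔ (w x : ℕ) = y := fun y x => by
      rw [Equiv.Perm.eq_inv_iff_eq, Fin.ext_iff]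
    have hp := hval ⟨i, Nat.lt_of_succ_lt h⟩ p
    have hp' := hval ⟨i + 1, h⟩ p
    have hq := hval ⟨i, Nat.lt_of_succ_lt h⟩ q
    have hq' := hval ⟨i + 1, h⟩ q
    have hpq : (w p : ℕ) = w q ↔ p = q := by rw [← Fin.ext_iff, w.injective.eq_iff]
    simp only [Finset.mem_filter, Finset.mem_product, Finset.mem_univ, true_and,
      Finset.mem_insert, Prod.mk.injEq, Equiv.Perm.mul_apply, Fin.lt_def, sw_apply_val h] at *
    generalize w⁻¹ ⟨i, Nat.lt_of_succ_lt h⟩ = a at *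
    generalize w⁻¹ ⟨i + 1, h⟩ = b at *
    simp only [Fin.ext_iff] at *
    generalize (w p : ℕ) = x at *
    generalize (w q : ℕ) = y at *
    split_ifs <;> omega
  rw [lenF, key, Finset.card_insert_of_notMem, lenF]
  rintro hmem
  have hlt := (Finset.mem_filter.mp hmem).2.2
  simp [Fin.lt_def, -Fin.val_fin_lt] at hlt

lemma lenF_sw_mul_add_one {N i : ℕ} (h : i + 1 < N) (w : Equiv.Perm (Fin N))
    (hw : ¬ w⁻¹ ⟨i, Nat.lt_of_succ_lt h⟩ < w⁻¹ ⟨i + 1, h⟩) :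
    lenF N (sw N i * w) + 1 = lenF N w := by
  have hne : w⁻¹ ⟨i, Nat.lt_of_succ_lt h⟩ ≠ w⁻¹ ⟨i + 1, h⟩ := fun e => by
    simpa using w⁻¹.injective e
  have := lenF_sw_mul h (sw N i * w) (by
    rw [mul_inv_rev, inv_eq_of_mul_eq_one_right (sw_mul_self N i), Equiv.Perm.mul_apply,
      Equiv.Perm.mul_apply, sw, dif_pos h, Equiv.swap_apply_left, Equiv.swap_apply_right]
    exact lt_of_le_of_ne (not_lt.mp hw) hne.symm)
  rw [← mul_assoc, sw_mul_self, one_mul] at this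
  exact this.symm

/-- The length of `w` as an integer-valued double sum of indicators. -/
lemma lenF_cast_eq_sum (N : ℕ) (w : Equiv.Perm (Fin N)) :
    (lenF N w : ℤ) = ∑ p, ∑ q, if p < q ∧ w q < w p then (1 : ℤ) else 0 := by
  rw [lenF, Finset.card_filter, Finset.sum_product]
  push_cast
  rfl

/-- Replacing the largest value, taken at position `r`, by the smallest one through `σ` changes
the length by `2r - (N - 1)`. -/
lemma lenF_sigmaF_mul {N : ℕ} (w : Equiv.Perm (Fin N)) (r : Fin N) (hr : (w r : ℕ) + 1 = N) :
    (lenF N w : ℤ) = lenF N (sigmaF N * w) + ((N : ℤ) - 1 - 2 * (r : ℕ)) := by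
  have key : (lenF N w : ℤ) - lenF N (sigmaF N * w) =
      ∑ p, ∑ q, ((if p = r then if r < q then (1 : ℤ) else 0 else 0) -
        if q = r then if p < r then (1 : ℤ) else 0 else 0) := by
    rw [lenF_cast_eq_sum, lenF_cast_eq_sum, ← Finset.sum_sub_distrib]
    refine Finset.sum_congr rfl fun p _ => ?_
    rw [← Finset.sum_sub_distrib]
    refine Finset.sum_congr rfl fun q _ => ?_
    have hval : ∀ x : Fin N, x = r ↔ (w x : ℕ) + 1 = N := fun x => by
      rw [← w.injective.eq_iff, Fin.ext_iff]
      omega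
    have hp := hval p
    have hq := hval q
    have hpl := (w p).isLt
    have hql := (w q).isLt
    simp only [Equiv.Perm.mul_apply, Fin.lt_def, sigmaF_apply_val]
    simp only [Fin.ext_iff] at *
    generalize (w p : ℕ) = x at *
    generalize (w q : ℕ) = y at *
    split_ifs <;> omega
  have h1 : ∑ p, ∑ q, (if p = r then if r < q then (1 : ℤ) else 0 else 0) =
      (N : ℤ) - 1 - (r : ℕ) := by
    rw [Finset.sum_comm]
    simp only [Finset.sum_ite_eq', Finset.mem_univ, if_true]
    rw [← Finset.sum_filter, Finset.sum_const, Finset.filter_lt_eq_Ioi, Fin.card_Ioi]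
    have := r.isLt
    simp
    omega
  have h2 : ∑ p, ∑ q, (if q = r then if p < r then (1 : ℤ) else 0 else 0) = (r : ℕ) := by
    simp only [Finset.sum_ite_eq', Finset.mem_univ, if_true]
    rw [← Finset.sum_filter, Finset.sum_const, Finset.filter_gt_eq_Iio, Fin.card_Iio]
    simp
  simp only [Finset.sum_sub_distrib, h1, h2] at key
  linarith

lemma IsHeckeT.apply_vplus {N : ℕ} {k : ℂ} (hk : k ≠ 0)
    {T : ℕ → Module.End ℂ (Equiv.Perm (Fin N) → ℂ)} (hT : IsHeckeT N k T) {i : ℕ}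
    (h : i + 1 < N) : T i (vplus N k) = k • vplus N k := by
  have hTw : ∀ w : Equiv.Perm (Fin N), T i (Pi.single w 1) =
      (Pi.single (sw N i * w) 1 : Equiv.Perm (Fin N) → ℂ) +
        (if w⁻¹ ⟨i, Nat.lt_of_succ_lt h⟩ < w⁻¹ ⟨i + 1, h⟩ then 0 else k - k⁻¹) •
          (Pi.single w 1 : Equiv.Perm (Fin N) → ℂ) := fun w => by
    rw [hT i h w]
    split_ifs
    · rw [zero_smul, add_zero]
    · rw [add_comm]
  have hre : ∑ w, k ^ lenF N w • (Pi.single (sw N i * w) 1 : Equiv.Perm (Fin N) → ℂ) =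
      ∑ w, k ^ lenF N (sw N i * w) • (Pi.single w 1 : Equiv.Perm (Fin N) → ℂ) := by
    refine Fintype.sum_equiv (Equiv.mulLeft (sw N i)) _ _ fun w => ?_
    rw [Equiv.coe_mulLeft, ← mul_assoc, sw_mul_self, one_mul]
  simp only [vplus, map_sum, map_smul, hTw, smul_add, Finset.sum_add_distrib]
  rw [hre, ← Finset.sum_add_distrib, Finset.smul_sum]
  refine Finset.sum_congr rfl fun w _ => ?_
  rw [smul_smul, smul_smul, ← add_smul]
  congr 1
  split_ifs with hw
  · rw [lenF_sw_mul h w hw]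
    ring
  · rw [← lenF_sw_mul_add_one h w hw]
    field_simp
    ring

lemma Rop_apply_of_apply_eq_smul {V : Type*} [AddCommGroup V] [Module ℂ V] {k : ℂ}
    {T : Module.End ℂ V} {v : V} (h : T v = k • v) (z : ℂ) : Rop k T z v = v := by
  simp [Rop, h]

/-- The iterates of `P_ζ` on `v₊`. -/
lemma pow_apply_vplus {N : ℕ} {k : ℂ} (hk : k ≠ 0) (ζ : Fin N → ℂ)
    {P : Module.End ℂ (Equiv.Perm (Fin N) → ℂ)} (m : Fin N) (hm : (m : ℕ) + 1 = N)
    (hP : ∀ w : Equiv.Perm (Fin N), P (Pi.single w 1) =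
      ζ (w⁻¹ m) • (Pi.single (sigmaF N * w) 1 : Equiv.Perm (Fin N) → ℂ))
    {i : ℕ} (hi : i ≤ N) :
    (P ^ i) (vplus N k) =
      ∑ w : Equiv.Perm (Fin N),
        (k ^ lenF N w *
            ∏ r ∈ Finset.univ.filter fun r : Fin N => ((w r : ℕ) < i),
              (k ^ ((N : ℤ) - 1 - 2 * ((r : ℕ) : ℤ)) * ζ r)) •
          (Pi.single w 1 : Equiv.Perm (Fin N) → ℂ) := by
  induction i with
  | zero => simp [vplus]
  | succ i ih =>
    rw [pow_succ', Module.End.mul_apply, ih (by omega), map_sum]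
    refine Fintype.sum_equiv (Equiv.mulLeft (sigmaF N)) _ _ fun w => ?_
    have hr : (w (w⁻¹ m) : ℕ) + 1 = N := by simpa using hm
    have hval : ∀ x : Fin N, x = w⁻¹ m ↔ (w x : ℕ) + 1 = N := fun x => by
      rw [Equiv.Perm.eq_inv_iff_eq, Fin.ext_iff]
      omega
    have hfilter : (Finset.univ.filter fun r : Fin N => ((sigmaF N * w) r : ℕ) < i + 1) =
        insert (w⁻¹ m) (Finset.univ.filter fun r : Fin N => (w r : ℕ) < i) := by
      ext x
      have hx := hval x
      simp only [Finset.mem_filter, Finset.mem_univ, true_and, Finset.mem_insert,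
        Equiv.Perm.mul_apply, sigmaF_apply_val, hx]
      split_ifs <;> omega
    rw [map_smul, hP, smul_smul, Equiv.coe_mulLeft, hfilter, Finset.prod_insert (by
      simp only [Finset.mem_filter, Finset.mem_univ, true_and]
      omega)]
    congr 1
    rw [← zpow_natCast k (lenF N w), lenF_sigmaF_mul w _ hr, zpow_add₀ hk, zpow_natCast]
    ring

/-- (i) `𝖳_i v₊ = k v₊` and hence `R_i(z) v₊ = v₊`; (ii) for `P_ζ e_w = ζ_{w⁻¹(N)} e_{σw}`,
`P_ζ^i v₊ = ∑_w k^{ℓ(w)} (∏_{r : w(r) ≤ i} k^{N+1-2r} ζ_r) e_w` (in 0-based labels the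
condition `w(r) ≤ i` reads `w(r) < i` and the exponent `N+1-2r` reads `N-1-2r`);
(iii) in particular `P_{k^{-δ}}^i v₊ = v₊` for `1 ≤ i ≤ N`, where
`(k^{-δ})_r = k^{2r-1-N}` in 1-based labels, i.e. `k^{2r+1-N}` in 0-based labels. -/
theorem vplus_properties (N : ℕ) (hN : 2 ≤ N) (k : ℂ) (hk : k ≠ 0)
    (T : ℕ → Module.End ℂ (Equiv.Perm (Fin N) → ℂ)) (hT : IsHeckeT N k T)
    (P : (Fin N → ℂ) → Module.End ℂ (Equiv.Perm (Fin N) → ℂ))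
    (hP : ∀ (ζ : Fin N → ℂ) (w : Equiv.Perm (Fin N)),
      P ζ (Pi.single w 1) =
        ζ (w⁻¹ ⟨N - 1, by omega⟩) • (Pi.single (sigmaF N * w) 1 : Equiv.Perm (Fin N) → ℂ)) :
    (∀ i, i + 1 < N → T i (vplus N k) = k • vplus N k) ∧
    (∀ i, i + 1 < N → ∀ z : ℂ, z ≠ 0 → z ≠ 1 → z ≠ (k ^ 2)⁻¹ →
      Rop k (T i) z (vplus N k) = vplus N k) ∧
    (∀ ζ : Fin N → ℂ, (∀ r, ζ r ≠ 0) → ∀ i : ℕ, 1 ≤ i → i ≤ N →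
      (P ζ ^ i) (vplus N k) =
        ∑ w : Equiv.Perm (Fin N),
          (k ^ lenF N w *
              ∏ r ∈ Finset.univ.filter fun r : Fin N => ((w r : ℕ) < i),
                (k ^ ((N : ℤ) - 1 - 2 * ((r : ℕ) : ℤ)) * ζ r)) •
            (Pi.single w 1 : Equiv.Perm (Fin N) → ℂ)) ∧
    (∀ i : ℕ, 1 ≤ i → i ≤ N →
      ((P fun r : Fin N => k ^ ((2 * (r : ℕ) + 1 : ℤ) - (N : ℤ))) ^ i) (vplus N k)
        = vplus N k) := by
  have hPow : ∀ ζ : Fin N → ℂ, ∀ i : ℕ, i ≤ N → _ := fun ζ i hi =>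
    pow_apply_vplus hk ζ ⟨N - 1, by omega⟩ (Nat.sub_add_cancel (by omega)) (hP ζ) hi
  refine ⟨fun i h => hT.apply_vplus hk h,
    fun i h z _ _ _ => Rop_apply_of_apply_eq_smul (hT.apply_vplus hk h) z,
    fun ζ _ i _ hi => hPow ζ i hi, fun i _ hi => ?_⟩
  rw [hPow _ i hi, vplus]
  refine Finset.sum_congr rfl fun w _ => ?_
  rw [Finset.prod_eq_one, mul_one]
  intro r _
  rw [← zpow_add₀ hk]
  convert zpow_zero k using 2
  ring
end

section
/- For 1 ≤ i ≤ N−1 define the intertwiner operator Ŝ_i on F by Ŝ_i f := (k − k^{−1} x_{i+1}/x_i)·(s_i f). Then: (i) Ŝ_i = M_{1 − x_{i+1}/x_i} ∘ (T̂_i − k·id) + M_{k − k^{−1} x_{i+1}/x_i}, where M_g denotes the operator of multiplication by g ∈ F; (ii) Ŝ_i ∘ Ŝ_i = M_{(k − k^{−1} x_{i+1}/x_i)(k − k^{−1} x_i/x_{i+1})}; (iii) the Ŝ_i satisfy the braid relations Ŝ_i Ŝ_{i+1} Ŝ_i = Ŝ_{i+1} Ŝ_i Ŝ_{i+1} for 1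 ≤ i ≤ N−2, and Ŝ_i Ŝ_j = Ŝ_j Ŝ_i whenever |i−j| ≥ 2. -/
/-- `F := ℂ(x_1, …, x_N)`, the field of fractions of the (Laurent) polynomial ring. -/
abbrev RatF (N : ℕ) := FractionRing (MvPolynomial (Fin N) ℂ)

/-- The coordinate `x_i ∈ F`. -/
noncomputable def Xv (N : ℕ) (i : Fin N) : RatF N :=
  algebraMap (MvPolynomial (Fin N) ℂ) (RatF N) (MvPolynomial.X i)

/-- The scalar `c ∈ ℂ` viewed in `F`. -/
noncomputable def Cc (N : ℕ) (c : ℂ) : RatF N :=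
  algebraMap (MvPolynomial (Fin N) ℂ) (RatF N) (MvPolynomial.C c)

/-- `act` is the action of `S_N` on `F` by field automorphisms, `w` acting by the
substitution `x_j ↦ x_{w(j)}` (and fixing the scalars `ℂ`). -/
def IsStdAction (N : ℕ) (act : Equiv.Perm (Fin N) →* RingAut (RatF N)) : Prop :=
  (∀ (w : Equiv.Perm (Fin N)) (j : Fin N), act w (Xv N j) = Xv N (w j)) ∧
  (∀ (w : Equiv.Perm (Fin N)) (c : ℂ), act w (Cc N c) = Cc N c)

/-- The Demazure–Lusztig operator
`T̂_i f := k f + c_k(x_i/x_{i+1}) (s_i f - f)`, where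
`c_k(x_i/x_{i+1}) = (k⁻¹ x_{i+1} - k x_i)/(x_{i+1} - x_i)` (0-based labels). -/
noncomputable def DL (N : ℕ) (k : ℂ) (act : Equiv.Perm (Fin N) →* RingAut (RatF N))
    (i : ℕ) (f : RatF N) : RatF N :=
  if h : i + 1 < N then
    Cc N k * f +
      (Cc N k⁻¹ * Xv N ⟨i + 1, h⟩ - Cc N k * Xv N ⟨i, Nat.lt_of_succ_lt h⟩) /
          (Xv N ⟨i + 1, h⟩ - Xv N ⟨i, Nat.lt_of_succ_lt h⟩) *
        (act (sw N i) f - f)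
  else f


/-- The intertwiner `Ŝ_i f := (k - k⁻¹ x_{i+1}/x_i) (s_i f)` (0-based labels). -/
noncomputable def Sop (N : ℕ) (k : ℂ) (act : Equiv.Perm (Fin N) →* RingAut (RatF N))
    (i : ℕ) (f : RatF N) : RatF N :=
  if h : i + 1 < N then
    (Cc N k - Cc N k⁻¹ * Xv N ⟨i + 1, h⟩ / Xv N ⟨i, Nat.lt_of_succ_lt h⟩) * act (sw N i) f
  else f

theorem Xv_injective (N : ℕ) : Function.Injective (Xv N) := fun _ _ h =>
  MvPolynomial.X_injective (IsFractionRing.injective (MvPolynomial (Fin N) ℂ) (RatF N) h)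

theorem Xv_ne_zero {N : ℕ} (i : Fin N) : Xv N i ≠ 0 := fun h =>
  MvPolynomial.X_ne_zero i
    (IsFractionRing.injective (MvPolynomial (Fin N) ℂ) (RatF N) (h.trans (map_zero _).symm))

/-- The factor `k - k⁻¹ x_b / x_a`. -/
noncomputable def intertwinerCoeff (N : ℕ) (k : ℂ) (a b : Fin N) : RatF N :=
  Cc N k - Cc N k⁻¹ * Xv N b / Xv N a

theorem IsStdAction.map_intertwinerCoeff {N : ℕ} {act : Equiv.Perm (Fin N) →* RingAut (RatF N)}
    (hact : IsStdAction N act) (k : ℂ) (w : Equiv.Perm (Fin N)) (a b : Fin N) :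
    act w (intertwinerCoeff N k a b) = intertwinerCoeff N k (w a) (w b) := by
  simp only [intertwinerCoeff, map_sub, map_div₀, map_mul, hact.1, hact.2]

theorem Sop_eq {N : ℕ} (k : ℂ) (act : Equiv.Perm (Fin N) →* RingAut (RatF N)) {i : ℕ}
    (h : i + 1 < N) (f : RatF N) :
    Sop N k act i f =
      intertwinerCoeff N k ⟨i, Nat.lt_of_succ_lt h⟩ ⟨i + 1, h⟩ *
        act (Equiv.swap ⟨i, Nat.lt_of_succ_lt h⟩ ⟨i + 1, h⟩) f := by
  simp only [Sop, sw, dif_pos h, intertwinerCoeff]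

theorem act_act {N : ℕ} (act : Equiv.Perm (Fin N) →* RingAut (RatF N))
    (v w : Equiv.Perm (Fin N)) (f : RatF N) : act v (act w f) = act (v * w) f := by
  rw [map_mul]; rfl

theorem swap_braid {α : Type*} [DecidableEq α] {a b c : α} (hab : a ≠ b) (hac : a ≠ c)
    (hbc : b ≠ c) :
    Equiv.swap a b * (Equiv.swap b c * Equiv.swap a b) =
      Equiv.swap b c * (Equiv.swap a b * Equiv.swap b c) := by
  ext x
  simp only [Equiv.Perm.mul_apply, Equiv.swap_apply_def]
  grind

theorem swap_comm_of_disjoint {α : Type*} [DecidableEq α] {a b c d : α} (hac : a ≠ c)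
    (had : a ≠ d) (hbc : b ≠ c) (hbd : b ≠ d) :
    Equiv.swap a b * Equiv.swap c d = Equiv.swap c d * Equiv.swap a b := by
  ext x
  simp only [Equiv.Perm.mul_apply, Equiv.swap_apply_def]
  grind

/-- Properties of the intertwiners: (i) `Ŝ_i = M_{1 - x_{i+1}/x_i} ∘ (T̂_i - k) +
M_{k - k⁻¹ x_{i+1}/x_i}`; (ii) `Ŝ_i ∘ Ŝ_i = M_{(k - k⁻¹x_{i+1}/x_i)(k - k⁻¹x_i/x_{i+1})}`;
(iii) the `Ŝ_i` satisfy the braid relations and commute for `|i - j| ≥ 2`. -/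
theorem intertwiner_properties (N : ℕ) (hN : 2 ≤ N) (q : ℝ) (hq0 : 0 < q) (hq1 : q < 1)
    (k : ℂ) (hk : k ≠ 0)
    (act : Equiv.Perm (Fin N) →* RingAut (RatF N)) (hact : IsStdAction N act) :
    (∀ (i : ℕ) (h : i + 1 < N) (f : RatF N),
      Sop N k act i f =
        (1 - Xv N ⟨i + 1, h⟩ / Xv N ⟨i, Nat.lt_of_succ_lt h⟩) *
            (DL N k act i f - Cc N k * f) +
          (Cc N k - Cc N k⁻¹ * Xv N ⟨i + 1, h⟩ / Xv N ⟨i, Nat.lt_of_succ_lt h⟩) * f) ∧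
    (∀ (i : ℕ) (h : i + 1 < N) (f : RatF N),
      Sop N k act i (Sop N k act i f) =
        (Cc N k - Cc N k⁻¹ * Xv N ⟨i + 1, h⟩ / Xv N ⟨i, Nat.lt_of_succ_lt h⟩) *
          ((Cc N k - Cc N k⁻¹ * Xv N ⟨i, Nat.lt_of_succ_lt h⟩ / Xv N ⟨i + 1, h⟩) * f)) ∧
    (∀ i, i + 2 < N → ∀ f : RatF N,
      Sop N k act i (Sop N k act (i + 1) (Sop N k act i f)) =
        Sop N k act (i + 1) (Sop N k act i (Sop N k act (i + 1) f))) ∧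
    (∀ i j, i + 1 < N → j + 1 < N → (i + 2 ≤ j ∨ j + 2 ≤ i) → ∀ f : RatF N,
      Sop N k act i (Sop N k act j f) = Sop N k act j (Sop N k act i f)) := by
  refine ⟨fun i h f => ?_, fun i h f => ?_, fun i h f => ?_, fun i j hi hj hij f => ?_⟩
  · have hne : Xv N ⟨i + 1, h⟩ - Xv N ⟨i, Nat.lt_of_succ_lt h⟩ ≠ 0 :=
      sub_ne_zero.2 fun e => by simpa using Xv_injective N e
    have h0 := Xv_ne_zero (⟨i, Nat.lt_of_succ_lt h⟩ : Fin N)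
    simp only [Sop, DL, dif_pos h]
    generalize Xv N ⟨i + 1, h⟩ = b at *
    generalize Xv N ⟨i, Nat.lt_of_succ_lt h⟩ = a at *
    generalize act (sw N i) f = g
    generalize Cc N k = c
    generalize Cc N k⁻¹ = c'
    field_simp
    ring
  · rw [Sop_eq k act h, Sop_eq k act h, map_mul, hact.map_intertwinerCoeff, act_act,
      Equiv.swap_apply_left, Equiv.swap_apply_right, Equiv.swap_mul_self, map_one]
    rfl
  · have h₁ : i + 1 < N := by omega
    simp only [Sop_eq k act h₁, Sop_eq k act (show i + 1 + 1 < N from h), map_mul,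
      hact.map_intertwinerCoeff]
    simp only [act_act]
    have hab : (⟨i, Nat.lt_of_succ_lt h₁⟩ : Fin N) ≠ ⟨i + 1, h₁⟩ := by simp
    have hac : (⟨i, Nat.lt_of_succ_lt h₁⟩ : Fin N) ≠ ⟨i + 1 + 1, h⟩ := by
      simp only [ne_eq, Fin.mk.injEq]; omega
    have hbc : (⟨i + 1, h₁⟩ : Fin N) ≠ ⟨i + 1 + 1, h⟩ := by simp
    generalize (⟨i, Nat.lt_of_succ_lt h₁⟩ : Fin N) = a at *
    generalize (⟨i + 1, h₁⟩ : Fin N) = b at *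
    generalize (⟨i + 1 + 1, h⟩ : Fin N) = c at *
    rw [swap_braid hab hac hbc]
    simp only [Equiv.swap_apply_left, Equiv.swap_apply_right,
      Equiv.swap_apply_of_ne_of_ne hab hac, Equiv.swap_apply_of_ne_of_ne hac.symm hbc.symm]
    ring
  · simp only [Sop_eq k act hi, Sop_eq k act hj, map_mul, hact.map_intertwinerCoeff]
    simp only [act_act]
    have hac : (⟨i, Nat.lt_of_succ_lt hi⟩ : Fin N) ≠ ⟨j, Nat.lt_of_succ_lt hj⟩ := by
      simp only [ne_eq, Fin.mk.injEq]; omega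
    have had : (⟨i, Nat.lt_of_succ_lt hi⟩ : Fin N) ≠ ⟨j + 1, hj⟩ := by
      simp only [ne_eq, Fin.mk.injEq]; omega
    have hbc : (⟨i + 1, hi⟩ : Fin N) ≠ ⟨j, Nat.lt_of_succ_lt hj⟩ := by
      simp only [ne_eq, Fin.mk.injEq]; omega
    have hbd : (⟨i + 1, hi⟩ : Fin N) ≠ ⟨j + 1, hj⟩ := by
      simp only [ne_eq, Fin.mk.injEq]; omega
    rw [swap_comm_of_disjoint hac had hbc hbd,
      Equiv.swap_apply_of_ne_of_ne hac.symm hbc.symm,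
      Equiv.swap_apply_of_ne_of_ne had.symm hbd.symm,
      Equiv.swap_apply_of_ne_of_ne hac had, Equiv.swap_apply_of_ne_of_ne hbc hbd]
    ring
end

section
/- Under assumptions (a)–(c), for every v ∈ V[(1,…,1)] (that is, v ∈ V with A_i^{(0)} v = v for all i = 1,…,M) there exists a unique V-valued formal power series Φ_v in z_1,…,z_M with constant coefficient Φ_v(0) = v that solves the holonomic system of q-difference equations, i.e., A_i·(𝒯_i Φ_v) = Φ_v for every i = 1,…,M. -/
/-- The product `A·f` of an `End(V)`-valued and a `V`-valued formal power series in
`M` variables: `(A·f)(m) = ∑_{m' + m'' = m} A(m')(f(m''))`. -/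
noncomputable def seriesMulV (M : ℕ) {V : Type*} [AddCommGroup V] [Module ℂ V]
    (A : (Fin M → ℕ) → Module.End ℂ V) (f : (Fin M → ℕ) → V) : (Fin M → ℕ) → V :=
  fun m => ∑ m' ∈ Fintype.piFinset fun i => Finset.range (m i + 1),
    A m' (f fun i => m i - m' i)

/-- The product of two `End(V)`-valued formal power series. -/
noncomputable def seriesMulE (M : ℕ) {V : Type*} [AddCommGroup V] [Module ℂ V]
    (A B : (Fin M → ℕ) → Module.End ℂ V) : (Fin M → ℕ) → Module.End ℂ V :=
  fun m => ∑ m' ∈ Fintype.piFinset fun i => Finset.range (m i + 1),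
    A m' * B fun i => m i - m' i

/-- The `q_i`-dilation operator `𝒯_i` on formal power series with coefficients in a
complex vector space `W`: `(𝒯_i f)(m) = q_i^{m_i} f(m)`. -/
noncomputable def dil (M : ℕ) {W : Type*} [AddCommGroup W] [Module ℂ W]
    (q : Fin M → ℝ) (i : Fin M) (f : (Fin M → ℕ) → W) : (Fin M → ℕ) → W :=
  fun m => ((q i : ℂ) ^ m i) • f m

/-- The joint eigenspace `V[γ] = {v : A0_i v = γ_i v for all i}`. -/
noncomputable def jointEig (M : ℕ) {V : Type*} [AddCommGroup V] [Module ℂ V]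
    (A0 : Fin M → Module.End ℂ V) (γ : Fin M → ℂ) : Submodule ℂ V :=
  ⨅ i, Module.End.eigenspace (A0 i) (γ i)

section FormalSeries

variable {M : ℕ} {V : Type*} [AddCommGroup V] [Module ℂ V]

lemma mem_piFinset_range_succ {m k : Fin M → ℕ} :
    (k ∈ Fintype.piFinset fun i => Finset.range (m i + 1)) ↔ k ≤ m := by
  simp [Fintype.mem_piFinset, Pi.le_def]

lemma seriesMulV_assoc (A B : (Fin M → ℕ) → Module.End ℂ V) (f : (Fin M → ℕ) → V) :
    seriesMulV M A (seriesMulV M B f) = seriesMulV M (seriesMulE M A B) f := by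
  funext m
  simp only [seriesMulV, seriesMulE, map_sum, LinearMap.sum_apply, Module.End.mul_apply]
  rw [Finset.sum_sigma', Finset.sum_sigma']
  refine Finset.sum_bij' (fun p _ => ⟨p.1 + p.2, p.1⟩) (fun p _ => ⟨p.2, p.1 - p.2⟩) ?_ ?_ ?_ ?_ ?_
  · rintro ⟨a, b⟩ h
    simp only [Finset.mem_sigma, mem_piFinset_range_succ, Pi.le_def, Pi.add_apply] at h ⊢
    exact ⟨fun i => by have := h.1 i; have := h.2 i; omega, fun i => by omega⟩
  · rintro ⟨a, b⟩ h
    simp only [Finset.mem_sigma, mem_piFinset_range_succ, Pi.le_def, Pi.sub_apply] at h ⊢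
    exact ⟨fun i => (h.2 i).trans (h.1 i), fun i => by have := h.1 i; have := h.2 i; omega⟩
  · rintro ⟨a, b⟩ h
    simp
  · rintro ⟨a, b⟩ h
    simp only [Finset.mem_sigma, mem_piFinset_range_succ] at h
    simp [add_tsub_cancel_of_le h.2]
  · rintro ⟨a, b⟩ h
    simp [Nat.sub_sub]

lemma dil_seriesMulV (q : Fin M → ℝ) (i : Fin M) (A : (Fin M → ℕ) → Module.End ℂ V)
    (f : (Fin M → ℕ) → V) :
    dil M q i (seriesMulV M A f) = seriesMulV M (dil M q i A) (dil M q i f) := by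
  funext m
  simp only [seriesMulV, dil, Finset.smul_sum]
  refine Finset.sum_congr rfl fun k hk => ?_
  rw [LinearMap.smul_apply, map_smul, smul_smul, ← pow_add,
    Nat.add_sub_cancel' (mem_piFinset_range_succ.1 hk i)]

lemma dil_comm (q : Fin M → ℝ) (i j : Fin M) (f : (Fin M → ℕ) → V) :
    dil M q i (dil M q j f) = dil M q j (dil M q i f) := by
  funext m
  exact smul_comm _ _ _

lemma seriesMulV_dil_sub (q : Fin M → ℝ) (i : Fin M) (A : (Fin M → ℕ) → Module.End ℂ V)
    (f g : (Fin M → ℕ) → V) :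
    seriesMulV M A (dil M q i (f - g)) =
      seriesMulV M A (dil M q i f) - seriesMulV M A (dil M q i g) := by
  funext m
  simp only [seriesMulV, dil, Pi.sub_apply, smul_sub, map_sub, Finset.sum_sub_distrib]

/-- Under the holonomy condition the operators `f ↦ A_i · 𝒯_i f` commute. -/
lemma seriesMulV_dil_comm (q : Fin M → ℝ) (A : Fin M → (Fin M → ℕ) → Module.End ℂ V)
    {i j : Fin M}
    (h : seriesMulE M (A i) (dil M q i (A j)) = seriesMulE M (A j) (dil M q j (A i)))
    (f : (Fin M → ℕ) → V) :
    seriesMulV M (A i) (dil M q i (seriesMulV M (A j) (dil M q j f))) =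
      seriesMulV M (A j) (dil M q j (seriesMulV M (A i) (dil M q i f))) := by
  rw [dil_seriesMulV, dil_seriesMulV, seriesMulV_assoc, seriesMulV_assoc, h, dil_comm]

lemma seriesMulV_dil_apply_of_forall_lt (q : Fin M → ℝ) (i : Fin M)
    (A : (Fin M → ℕ) → Module.End ℂ V) {f : (Fin M → ℕ) → V} {m : Fin M → ℕ}
    (hf : ∀ k < m, f k = 0) :
    seriesMulV M A (dil M q i f) m = (q i : ℂ) ^ m i • A 0 (f m) := by
  simp only [seriesMulV, dil]
  rw [Finset.sum_eq_single 0]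
  · simp
  · intro k hk hk0
    rw [hf, smul_zero, map_zero]
    refine lt_of_le_of_ne (fun j => Nat.sub_le _ _) fun h => hk0 ?_
    funext j
    have := congrFun h j
    have := mem_piFinset_range_succ.1 hk j
    simp only [Pi.zero_apply] at *
    omega
  · intro h
    exact absurd (mem_piFinset_range_succ.2 zero_le) h

/-- If the joint eigenspaces span, a number that is not the `i`-th component of any joint
eigenvalue is not an eigenvalue of `A0 i`. -/
lemma eigenspace_eq_bot_of_jointEig {A0 : Fin M → Module.End ℂ V}
    (h : (⨆ γ : Fin M → ℂ, jointEig M A0 γ) = ⊤) {i : Fin M} {μ : ℂ}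
    (hμ : ∀ γ, jointEig M A0 γ ≠ ⊥ → γ i ≠ μ) :
    Module.End.eigenspace (A0 i) μ = ⊥ := by
  have hind := Module.End.eigenspaces_iSupIndep (A0 i) μ
  have htop : (⨆ (ν : ℂ) (_ : ν ≠ μ), Module.End.eigenspace (A0 i) ν) = ⊤ := by
    rw [eq_top_iff, ← h]
    refine iSup_le fun γ => ?_
    by_cases hγ : jointEig M A0 γ = ⊥
    · simp [hγ]
    · exact (iInf_le _ i).trans (le_iSup₂_of_le (γ i) (hμ γ hγ) le_rfl)
  rw [htop] at hind
  exact disjoint_top.1 hind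

/-- Well-founded recursion in which the value at `m` is computed from a function that agrees
with the solution below `m` and vanishes at `m`. -/
lemma exists_eq_apply_truncation {ι : Type*} [Preorder ι] [WellFoundedLT ι] {W : Type*} [Zero W]
    (G : ι → (ι → W) → W) :
    ∃ f : ι → W, ∀ m, ∃ g : ι → W, (∀ k < m, g k = f k) ∧ g m = 0 ∧ f m = G m g := by
  classical
  let F : ∀ m : ι, (∀ k, k < m → W) → W := fun m r => G m fun k => if h : k < m then r k h else 0
  refine ⟨wellFounded_lt.fix F, fun m => ⟨fun k => if k < m then wellFounded_lt.fix F k else 0,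
    fun k hk => if_pos hk, if_neg (lt_irrefl m), ?_⟩⟩
  rw [WellFounded.fix_eq]
  simp [F]

lemma eq_zero_of_pow_smul_eq {q : Fin M → ℝ} (hq : ∀ i, 0 < q i ∧ q i < 1)
    {A0 : Fin M → Module.End ℂ V}
    (hb : (⨆ γ : Fin M → ℂ, jointEig M A0 γ) = ⊤)
    (hc : ∀ γ : Fin M → ℂ, jointEig M A0 γ ≠ ⊥ →
      ∀ (i : Fin M) (n : ℕ), 1 ≤ n → γ i ≠ ((q i : ℂ)) ^ (-(n : ℤ)))
    {i : Fin M} {n : ℕ} (hn : n ≠ 0) {x : V} (hx : (q i : ℂ) ^ n • A0 i x = x) : x = 0 := by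
  have hq0 : (q i : ℂ) ^ n ≠ 0 := pow_ne_zero _ (by exact_mod_cast (hq i).1.ne')
  have hbot := eigenspace_eq_bot_of_jointEig hb (i := i) (μ := (q i : ℂ) ^ (-(n : ℤ)))
    fun γ hγ => hc γ hγ i n (Nat.one_le_iff_ne_zero.2 hn)
  rw [← Submodule.mem_bot ℂ, ← hbot, Module.End.mem_eigenspace_iff, zpow_neg, zpow_natCast,
    eq_inv_smul_iff₀ hq0, hx]

end FormalSeries

/-- Under the assumptions (a) holonomy, (b) `V` is the (direct) sum of the joint
eigenspaces of the constant coefficients `A_i(0)`, and (c) no eigenvalue tuple has a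
component in `q_i^{-ℕ}`, for every `v` with `A_i(0) v = v` for all `i` there is a unique
`V`-valued formal power series solution `Φ_v` of the holonomic system
`A_i · (𝒯_i Φ) = Φ` (`i = 1, …, M`) with constant coefficient `Φ_v(0) = v`. -/
theorem formal_power_series_solution (M : ℕ) (hM : 1 ≤ M)
    {V : Type*} [AddCommGroup V] [Module ℂ V] [FiniteDimensional ℂ V]
    (q : Fin M → ℝ) (hq : ∀ i, 0 < q i ∧ q i < 1)
    (A : Fin M → (Fin M → ℕ) → Module.End ℂ V)
    (ha : ∀ i j, seriesMulE M (A i) (dil M q i (A j)) = seriesMulE M (A j) (dil M q j (A i)))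
    (hb : (⨆ γ : Fin M → ℂ, jointEig M (fun i => A i 0) γ) = ⊤)
    (hc : ∀ γ : Fin M → ℂ, jointEig M (fun i => A i 0) γ ≠ ⊥ →
      ∀ (i : Fin M) (n : ℕ), 1 ≤ n → γ i ≠ ((q i : ℂ)) ^ (-(n : ℤ)))
    (v : V) (hv : v ∈ jointEig M (fun i => A i 0) fun _ => 1) :
    ∃! Φ : (Fin M → ℕ) → V,
      Φ 0 = v ∧ ∀ i, seriesMulV M (A i) (dil M q i Φ) = Φ := by
  have hinj {i : Fin M} {n : ℕ} (hn : n ≠ 0) {x : V} (hx : (q i : ℂ) ^ n • A i 0 x = x) :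
      x = 0 := eq_zero_of_pow_smul_eq hq hb hc hn hx
  have hsolve (i : Fin M) (n : ℕ) (hn : n ≠ 0) (y : V) :
      ∃ x, x - (q i : ℂ) ^ n • A i 0 x = y := by
    have hinj' : Function.Injective (LinearMap.id - (q i : ℂ) ^ n • A i 0 : Module.End ℂ V) := by
      rw [injective_iff_map_eq_zero]
      intro x hx
      exact hinj hn (sub_eq_zero.1 hx).symm
    exact LinearMap.injective_iff_surjective.1 hinj' y
  have hex (m : Fin M → ℕ) (hm : m ≠ 0) : ∃ i, m i ≠ 0 := Function.ne_iff.1 hm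
  have : Nonempty (Fin M) := ⟨⟨0, hM⟩⟩
  choose! idx hidx using hex
  choose! S hS using hsolve
  obtain ⟨Φ, hΦ⟩ := exists_eq_apply_truncation fun (m : Fin M → ℕ) g =>
    if m = 0 then v else S (idx m) (m (idx m)) (seriesMulV M (A (idx m)) (dil M q (idx m) g) m)
  have hΦ0 : Φ 0 = v := by
    obtain ⟨g, -, -, h⟩ := hΦ 0
    simpa using h
  have hΦidx (m : Fin M → ℕ) (hm : m ≠ 0) :
      seriesMulV M (A (idx m)) (dil M q (idx m) Φ) m = Φ m := by
    obtain ⟨g, hlt, hg, h⟩ := hΦ m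
    rw [if_neg hm] at h
    have h1 := hS (idx m) _ (hidx m hm) (seriesMulV M (A (idx m)) (dil M q (idx m) g) m)
    have h2 := seriesMulV_dil_apply_of_forall_lt q (idx m) (A (idx m)) (f := Φ - g) (m := m)
      fun k hk => by rw [Pi.sub_apply, hlt k hk, sub_self]
    rw [seriesMulV_dil_sub, Pi.sub_apply, Pi.sub_apply, hg, sub_zero] at h2
    rw [← h, ← h2] at h1
    rw [sub_eq_iff_eq_add, add_sub_cancel] at h1
    exact h1.symm
  have hres (m : Fin M → ℕ) : ∀ i, (seriesMulV M (A i) (dil M q i Φ) - Φ) m = 0 := by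
    induction m using WellFoundedLT.induction with
    | _ m ih =>
      intro j
      by_cases hm : m = 0
      · subst hm
        rw [Pi.sub_apply, seriesMulV_dil_apply_of_forall_lt _ _ _ fun k hk =>
          absurd hk not_lt_zero, hΦ0]
        have := (Submodule.mem_iInf _).1 hv j
        rw [Module.End.mem_eigenspace_iff] at this
        simp [this]
      · set i := idx m
        have hi : (seriesMulV M (A i) (dil M q i Φ) - Φ) m = 0 := sub_eq_zero.2 (hΦidx m hm)
        have h1 := seriesMulV_dil_apply_of_forall_lt q i (A i) fun k hk => ih k hk j
        have h2 := seriesMulV_dil_apply_of_forall_lt q j (A j) fun k hk => ih k hk i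
        rw [hi, map_zero, smul_zero, seriesMulV_dil_sub, seriesMulV_dil_comm q A (ha j i),
          Pi.sub_apply, sub_eq_zero] at h2
        refine hinj (hidx m hm) (h1.symm.trans ?_)
        rw [seriesMulV_dil_sub, Pi.sub_apply, h2, Pi.sub_apply, hΦidx m hm]
  refine ⟨Φ, ⟨hΦ0, fun i => funext fun m => sub_eq_zero.1 (hres m i)⟩, ?_⟩
  rintro Ψ ⟨hΨ0, hΨ⟩
  rw [← sub_eq_zero]
  funext m
  induction m using WellFoundedLT.induction with
  | _ m ih =>
    by_cases hm : m = 0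
    · simp [hm, hΨ0, hΦ0]
    · have h := seriesMulV_dil_apply_of_forall_lt q (idx m) (A (idx m)) ih
      rw [seriesMulV_dil_sub, hΨ, Pi.sub_apply, hΦidx m hm] at h
      exact hinj (hidx m hm) h.symm
end

section
/- Fix a norm on V and equip End(V) with the operator norm. Under assumptions (a)–(c), suppose in addition that there exists ε > 0 such that for each i = 1,…,M and every real r with 0 < r < ε, Σ_{m ∈ ℕ^M} ‖A_i(m)‖ · r^{m_1+⋯+m_M} < ∞ (so each A_i converges normally on compacta of the open polydisc of radius ε). Then, for every v ∈ V[(1,…,1)], there exists ε' > 0 such that for every 0 < r < ε', Σ_{m ∈ ℕ^M} ‖Φ_v(m)‖ · r^{m_1+⋯+m_M} < ∞, where Φ_v is the unique formal power series solution with constant coefficient v; in particular the series z ↦ Σ_m Φ_v(m) z^m converges normally on compacta of the open polydisc {z ∈ ℂ^M : |z_i| < ε' for all i} and defines an analytic V-valued function there. -/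
/-- Geometric series in several variables are summable. -/
theorem summable_pow_sum_of_lt_one (M : ℕ) {x : ℝ} (h0 : 0 ≤ x) (h1 : x < 1) :
    Summable fun m : Fin M → ℕ => x ^ ∑ j, m j := by
  refine summable_of_sum_le (c := ((1 - x)⁻¹) ^ M) (fun m => pow_nonneg h0 _) fun s => ?_
  obtain ⟨N, hN⟩ : ∃ N, ∀ m ∈ s, ∀ j, m j < N := by
    refine ⟨s.sup (fun m => ∑ j, m j) + 1, fun m hm j => Nat.lt_succ_of_le ?_⟩
    exact (Finset.single_le_sum (fun _ _ => Nat.zero_le _) (Finset.mem_univ j)).trans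
      (Finset.le_sup (f := fun m : Fin M → ℕ => ∑ j, m j) hm)
  calc ∑ m ∈ s, x ^ ∑ j, m j
      ≤ ∑ m ∈ Fintype.piFinset fun _ : Fin M => Finset.range N, x ^ ∑ j, m j :=
        Finset.sum_le_sum_of_subset_of_nonneg
          (fun m hm => Fintype.mem_piFinset.2 fun j => Finset.mem_range.2 (hN m hm j))
          fun _ _ _ => pow_nonneg h0 _
    _ = ∏ _j : Fin M, ∑ k ∈ Finset.range N, x ^ k := by
        rw [Finset.prod_univ_sum]
        exact Finset.sum_congr rfl fun m _ => (Finset.prod_pow_eq_pow_sum _ _ _).symm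
    _ ≤ ((1 - x)⁻¹) ^ M := by
        rw [Finset.prod_const, Finset.card_univ, Fintype.card_fin]
        refine pow_le_pow_left₀ (Finset.sum_nonneg fun _ _ => pow_nonneg h0 _) ?_ M
        rw [← tsum_geometric_of_lt_one h0 h1]
        exact (summable_geometric_of_lt_one h0 h1).sum_le_tsum _ fun _ _ => pow_nonneg h0 _

/-- If every operator `1 - q ^ n T` with `n ≥ 1` is invertible, then these operators are
bounded below uniformly in `n`. -/
theorem exists_norm_le_mul_norm_sub_pow_smul {V : Type*} [NormedAddCommGroup V]
    [NormedSpace ℂ V] [CompleteSpace V] (T : V →L[ℂ] V) {q : ℂ} (hq : ‖q‖ < 1)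
    (hT : ∀ n : ℕ, 1 ≤ n → IsUnit (1 - q ^ n • T)) :
    ∃ C : ℝ, 0 ≤ C ∧ ∀ n : ℕ, 1 ≤ n → ∀ w : V, ‖w‖ ≤ C * ‖w - q ^ n • T w‖ := by
  have hlim : Filter.Tendsto (fun n : ℕ => 1 - q ^ n • T) Filter.atTop (nhds 1) := by
    simpa using tendsto_const_nhds.sub
      ((tendsto_pow_atTop_nhds_zero_of_norm_lt_one hq).smul_const T)
  have hinv : ContinuousAt Ring.inverse (1 : V →L[ℂ] V) := by
    simpa using NormedRing.inverse_continuousAt (1 : (V →L[ℂ] V)ˣ)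
  obtain ⟨C, hC⟩ := (hinv.tendsto.comp hlim).norm.bddAbove_range
  have hC' : ∀ n : ℕ, ‖Ring.inverse (1 - q ^ n • T)‖ ≤ C := fun n => hC ⟨n, rfl⟩
  refine ⟨C, (norm_nonneg _).trans (hC' 0), fun n hn w => ?_⟩
  have hw : w = Ring.inverse (1 - q ^ n • T) (w - q ^ n • T w) := by
    have := congrArg (fun S : V →L[ℂ] V => S w) (Ring.inverse_mul_cancel _ (hT n hn))
    simpa using this.symm
  calc ‖w‖ = ‖Ring.inverse (1 - q ^ n • T) (w - q ^ n • T w)‖ := by rw [← hw]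
    _ ≤ ‖Ring.inverse (1 - q ^ n • T)‖ * ‖w - q ^ n • T w‖ := ContinuousLinearMap.le_opNorm _ _
    _ ≤ C * ‖w - q ^ n • T w‖ := mul_le_mul_of_nonneg_right (hC' n) (norm_nonneg _)

/-- Under the nonresonance condition, `1 - q_i ^ n A_i^{(0)}` is invertible for `n ≥ 1`. -/
theorem isUnit_one_sub_pow_smul_of_jointEig (M : ℕ) {V : Type*} [NormedAddCommGroup V]
    [NormedSpace ℂ V] [FiniteDimensional ℂ V] (A0 : Fin M → Module.End ℂ V)
    (hb : (⨆ γ : Fin M → ℂ, jointEig M A0 γ) = ⊤) {q : ℂ} (i : Fin M) (n : ℕ)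
    (hc : ∀ γ : Fin M → ℂ, jointEig M A0 γ ≠ ⊥ → γ i ≠ q ^ (-(n : ℤ))) :
    IsUnit (1 - q ^ n • LinearMap.toContinuousLinearMap (A0 i)) := by
  have hsurj : LinearMap.range (1 - q ^ n • A0 i) = ⊤ := by
    rw [eq_top_iff, ← hb]
    refine iSup_le fun γ w hw => ?_
    by_cases hw0 : w = 0
    · simp [hw0]
    have hγ : γ i ≠ q ^ (-(n : ℤ)) := hc γ fun h => hw0 (by simpa [h] using hw)
    have hw' : A0 i w = γ i • w :=
      Module.End.mem_eigenspace_iff.1 ((Submodule.mem_iInf _).1 hw i)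
    have hne : 1 - q ^ n * γ i ≠ 0 := fun h => hγ <| by
      rw [zpow_neg, zpow_natCast]
      exact eq_inv_of_mul_eq_one_right (sub_eq_zero.1 h).symm
    refine ⟨(1 - q ^ n * γ i)⁻¹ • w, ?_⟩
    rw [map_smul, LinearMap.sub_apply, LinearMap.smul_apply, hw', Module.End.one_apply, smul_smul]
    nth_rewrite 1 [← one_smul ℂ w]
    rw [← sub_smul, smul_smul, inv_mul_cancel₀ hne, one_smul]
  have hunit : IsUnit (1 - q ^ n • A0 i) := (LinearMap.isUnit_iff_range_eq_top _).2 hsurj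
  have h := hunit.map (Module.End.toContinuousLinearMap (𝕜 := ℂ) V)
  rw [map_sub, map_one, map_smul] at h
  exact h

/-- A nonnegative family on multi-indices that is dominated by its convolution with a series of
positive radius of convergence grows at most geometrically. -/
theorem exists_mul_pow_le_of_le_convolution (M : ℕ) (B f : (Fin M → ℕ) → ℝ)
    (hB : ∀ m, 0 ≤ B m) (hf : ∀ m, 0 ≤ f m) {C r₁ : ℝ} (hC : 0 ≤ C) (hr₁ : 0 < r₁)
    (hs : Summable fun m => B m * r₁ ^ ∑ j, m j)
    (hrec : ∀ m, m ≠ 0 → f m ≤ C * ∑ k ∈ (Fintype.piFinset fun i =>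
      Finset.range (m i + 1)).erase 0, B k * f fun i => m i - k i) :
    ∃ r₀ : ℝ, 0 < r₀ ∧ ∀ m, f m * r₀ ^ ∑ j, m j ≤ f 0 := by
  set S := ∑' m, B m * r₁ ^ ∑ j, m j
  have hS : 0 ≤ S := tsum_nonneg fun m => mul_nonneg (hB m) (pow_nonneg hr₁.le _)
  have hD : 0 < C * S + 1 := by positivity
  set x := (C * S + 1)⁻¹
  have hx0 : 0 < x := inv_pos.2 hD
  have hx1 : x ≤ 1 := inv_le_one_of_one_le₀ (by nlinarith [mul_nonneg hC hS])
  have hCx : C * (x * S) ≤ 1 := by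
    have : (C * S + 1) * x = 1 := mul_inv_cancel₀ hD.ne'
    nlinarith
  refine ⟨x * r₁, mul_pos hx0 hr₁, fun m => ?_⟩
  induction hn : ∑ j, m j using Nat.strong_induction_on generalizing m with
  | _ n ih =>
  subst hn
  by_cases hm : m = 0
  · simp [hm]
  set F := (Fintype.piFinset fun i => Finset.range (m i + 1)).erase 0
  have hterm : ∀ k ∈ F, (B k * f fun i => m i - k i) * (x * r₁) ^ ∑ j, m j ≤
      B k * r₁ ^ (∑ j, k j) * (x * f 0) := by
    intro k hk
    obtain ⟨hk0, hkF⟩ := Finset.mem_erase.1 hk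
    have hle : ∀ i, k i ≤ m i := fun i =>
      Nat.lt_succ_iff.1 (Finset.mem_range.1 (Fintype.mem_piFinset.1 hkF i))
    have hsum : ∑ j, m j = ∑ j, k j + ∑ j, (m j - k j) := by
      rw [← Finset.sum_add_distrib]
      exact Finset.sum_congr rfl fun j _ => (Nat.add_sub_of_le (hle j)).symm
    have hkpos : ∑ j, k j ≠ 0 := fun h => hk0 <| by
      ext j
      exact Finset.sum_eq_zero_iff.1 h j (Finset.mem_univ j)
    have hind := ih _ (by omega) (fun i => m i - k i) rfl
    have hxk : x ^ (∑ j, k j) ≤ x := pow_le_of_le_one hx0.le hx1 hkpos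
    calc (B k * f fun i => m i - k i) * (x * r₁) ^ ∑ j, m j
        = B k * r₁ ^ (∑ j, k j) * (x ^ (∑ j, k j) *
            ((f fun i => m i - k i) * (x * r₁) ^ ∑ j, (m j - k j))) := by
          rw [hsum, pow_add, mul_pow x r₁ (∑ j, k j)]; ring
      _ ≤ B k * r₁ ^ (∑ j, k j) * (x * f 0) :=
          mul_le_mul_of_nonneg_left
            (mul_le_mul hxk hind (mul_nonneg (hf _) (by positivity)) hx0.le)
            (mul_nonneg (hB k) (by positivity))
  calc f m * (x * r₁) ^ ∑ j, m j
      ≤ (C * ∑ k ∈ F, B k * f fun i => m i - k i) * (x * r₁) ^ ∑ j, m j :=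
        mul_le_mul_of_nonneg_right (hrec m hm) (by positivity)
    _ = C * ∑ k ∈ F, (B k * f fun i => m i - k i) * (x * r₁) ^ ∑ j, m j := by
        rw [mul_assoc, Finset.sum_mul]
    _ ≤ C * ∑ k ∈ F, B k * r₁ ^ (∑ j, k j) * (x * f 0) :=
        mul_le_mul_of_nonneg_left (Finset.sum_le_sum hterm) hC
    _ ≤ C * (S * (x * f 0)) := by
        rw [← Finset.sum_mul]
        refine mul_le_mul_of_nonneg_left (mul_le_mul_of_nonneg_right ?_
          (mul_nonneg hx0.le (hf 0))) hC
        exact hs.sum_le_tsum _ fun k _ => mul_nonneg (hB k) (pow_nonneg hr₁.le _)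
    _ = C * (x * S) * f 0 := by ring
    _ ≤ f 0 := mul_le_of_le_one_left (hf 0) hCx

/-- Coefficientwise form of the equation `A_i · 𝒯_i Φ = Φ`, with the term of `A_i(0)` moved to
the left-hand side. -/
theorem sub_pow_smul_eq_sum_erase (M : ℕ) {V : Type*} [AddCommGroup V] [Module ℂ V]
    (q : Fin M → ℝ) (i : Fin M) (A : (Fin M → ℕ) → Module.End ℂ V) (Φ : (Fin M → ℕ) → V)
    (hΦ : seriesMulV M A (dil M q i Φ) = Φ) (m : Fin M → ℕ) :
    Φ m - (q i : ℂ) ^ m i • A 0 (Φ m) =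
      ∑ k ∈ (Fintype.piFinset fun i => Finset.range (m i + 1)).erase 0,
        A k ((q i : ℂ) ^ (m i - k i) • Φ fun i => m i - k i) := by
  have h0 : (0 : Fin M → ℕ) ∈ Fintype.piFinset fun i => Finset.range (m i + 1) :=
    Fintype.mem_piFinset.2 fun j => by simp
  have h := congrFun hΦ m
  rw [seriesMulV, ← Finset.add_sum_erase _ _ h0] at h
  rw [sub_eq_iff_eq_add', ← map_smul]
  exact h.symm

/-- Under assumptions (a)–(c) and the additional convergence assumption (e) that each
`A_i` converges normally on compacta of a polydisc of radius `ε > 0` (expressed as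
summability of `‖A_i(m)‖ r^{|m|}` for all `0 < r < ε`, using the operator norm), the
unique formal power series solution `Φ_v` with constant coefficient `v ∈ V[(1,…,1)]`
has a positive radius of convergence: there is `ε' > 0` such that
`∑_m ‖Φ_v(m)‖ r^{|m|} < ∞` for all `0 < r < ε'`; in particular `z ↦ ∑_m Φ_v(m) z^m`
converges normally on compacta of the polydisc of radius `ε'` and is analytic there. -/
theorem convergence_of_formal_solution (M : ℕ) (hM : 1 ≤ M)
    {V : Type*} [NormedAddCommGroup V] [NormedSpace ℂ V] [FiniteDimensional ℂ V]
    (q : Fin M → ℝ) (hq : ∀ i, 0 < q i ∧ q i < 1)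
    (A : Fin M → (Fin M → ℕ) → Module.End ℂ V)
    (ha : ∀ i j, seriesMulE M (A i) (dil M q i (A j)) = seriesMulE M (A j) (dil M q j (A i)))
    (hb : (⨆ γ : Fin M → ℂ, jointEig M (fun i => A i 0) γ) = ⊤)
    (hc : ∀ γ : Fin M → ℂ, jointEig M (fun i => A i 0) γ ≠ ⊥ →
      ∀ (i : Fin M) (n : ℕ), 1 ≤ n → γ i ≠ ((q i : ℂ)) ^ (-(n : ℤ)))
    (he : ∃ ε : ℝ, 0 < ε ∧ ∀ (i : Fin M) (r : ℝ), 0 < r → r < ε →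
      Summable fun m : Fin M → ℕ =>
        ‖LinearMap.toContinuousLinearMap (A i m)‖ * r ^ (∑ j, m j))
    (v : V) (hv : v ∈ jointEig M (fun i => A i 0) fun _ => 1)
    (Φ : (Fin M → ℕ) → V) (hΦ0 : Φ 0 = v)
    (hΦ : ∀ i, seriesMulV M (A i) (dil M q i Φ) = Φ) :
    ∃ ε' : ℝ, 0 < ε' ∧ ∀ r : ℝ, 0 < r → r < ε' →
      Summable fun m : Fin M → ℕ => ‖Φ m‖ * r ^ (∑ j, m j) := by
  have : CompleteSpace V := FiniteDimensional.complete ℂ V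
  have hqn : ∀ i, ‖(q i : ℂ)‖ = q i := fun i => by
    rw [Complex.norm_real, Real.norm_of_nonneg (hq i).1.le]
  choose C hC0 hC using fun i => exists_norm_le_mul_norm_sub_pow_smul
    (LinearMap.toContinuousLinearMap (A i 0)) (q := q i) (by rw [hqn]; exact (hq i).2)
    fun n hn => isUnit_one_sub_pow_smul_of_jointEig M (fun i => A i 0) hb i n
      fun γ hγ => hc γ hγ i n hn
  obtain ⟨ε, hε, hsum⟩ := he
  set B : (Fin M → ℕ) → ℝ := fun m => ∑ i, ‖LinearMap.toContinuousLinearMap (A i m)‖ with hBdef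
  have hBle : ∀ i m, ‖LinearMap.toContinuousLinearMap (A i m)‖ ≤ B m := fun i m =>
    Finset.single_le_sum (f := fun i => ‖LinearMap.toContinuousLinearMap (A i m)‖)
      (fun _ _ => norm_nonneg _) (Finset.mem_univ i)
  have hB : ∀ m, 0 ≤ B m := fun m => Finset.sum_nonneg fun _ _ => norm_nonneg _
  have hBs : Summable fun m => B m * (ε / 2) ^ ∑ j, m j := by
    simp only [hBdef, Finset.sum_mul]
    exact summable_sum fun i _ => hsum i (ε / 2) (half_pos hε) (half_lt_self hε)
  obtain ⟨r₀, hr₀, hbound⟩ := exists_mul_pow_le_of_le_convolution M B (fun m => ‖Φ m‖) hB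
    (fun _ => norm_nonneg _) (Finset.sum_nonneg fun i _ => hC0 i) (half_pos hε) hBs <| by
      intro m hm
      obtain ⟨i, hi⟩ := Function.ne_iff.1 hm
      refine (hC i (m i) (Nat.one_le_iff_ne_zero.2 hi) (Φ m)).trans
        (mul_le_mul (Finset.single_le_sum (fun i _ => hC0 i) (Finset.mem_univ i)) ?_
          (norm_nonneg _) (Finset.sum_nonneg fun i _ => hC0 i))
      rw [LinearMap.coe_toContinuousLinearMap', sub_pow_smul_eq_sum_erase M q i (A i) Φ (hΦ i) m]
      refine norm_sum_le_of_le _ fun k _ => ?_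
      refine ((LinearMap.toContinuousLinearMap (A i k)).le_opNorm _).trans
        (mul_le_mul (hBle i k) ?_ (norm_nonneg _) (hB k))
      rw [norm_smul, norm_pow, hqn]
      exact mul_le_of_le_one_left (norm_nonneg _) (pow_le_one₀ (hq i).1.le (hq i).2.le)
  refine ⟨r₀, hr₀, fun r hr hrr₀ => ?_⟩
  refine Summable.of_nonneg_of_le (fun m => mul_nonneg (norm_nonneg _) (pow_nonneg hr.le _))
    (fun m => ?_) ((summable_pow_sum_of_lt_one M (div_nonneg hr.le hr₀.le)
      ((div_lt_one hr₀).2 hrr₀)).mul_left ‖Φ 0‖)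
  calc ‖Φ m‖ * r ^ (∑ j, m j)
      = ‖Φ m‖ * r₀ ^ (∑ j, m j) * (r / r₀) ^ (∑ j, m j) := by
        rw [mul_assoc, ← mul_pow, mul_div_cancel₀ _ hr₀.ne']
    _ ≤ ‖Φ 0‖ * (r / r₀) ^ (∑ j, m j) :=
        mul_le_mul_of_nonneg_right (hbound m) (pow_nonneg (div_nonneg hr.le hr₀.le) _)
end
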